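/- arXiv:2508.07876 — 2 statements merged into one kernel-verified Lean document; each statement's English description precedes it below -/
import Mathlib

section
/- The set of synchronized solution points satisfies S_Φ^sync = (S_Φ ∩ π⁻¹(APer(φ))) ∪ SPer(Φ,φ), and consequently S_Φ \ S_Φ^sync = (S_Φ ∩ APer(Φ) ∩ π⁻¹(Per(φ))) ∪ (Per(Φ) \ SPer(Φ,φ)). -/
open Set Filter Topology

/-- The set of points through which a (bi-infinite) solution of `Φ` passes. -/
def SolSet {𝔛 : Type*} (Φ : 𝔛 → 𝔛) : Set 𝔛 :=
  {x | ∃ χ : ℤ → 𝔛, χ 0 = x ∧ ∀ t : ℤ, χ (t + 1) = Φ (χ t)}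

/-- The bi-infinite orbit of `z0` under a bijection `φ`:
`z ∈ orb φ z0` iff `z = φ^t z0` for some `t ∈ ℤ`. -/
def orb {𝒵 : Type*} (φ : 𝒵 → 𝒵) (z0 : 𝒵) : Set 𝒵 :=
  {z | ∃ n : ℕ, φ^[n] z0 = z ∨ φ^[n] z = z0}

/-- The set of points through which a synchronized solution of the bundle map `Φ`
(over `φ`, with bundle projection `π`) passes.  A synchronized solution through `x`
is a map `χ` defined on the orbit of `π x` with `χ (π x) = x` and `Φ ∘ χ = χ ∘ φ`
(formalized via an arbitrary extension of `χ` to all of `𝒵`). -/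
def SyncSolSet {𝔛 𝒵 : Type*} (Φ : 𝔛 → 𝔛) (φ : 𝒵 → 𝒵) (π : 𝔛 → 𝒵) : Set 𝔛 :=
  {x | ∃ χ : 𝒵 → 𝔛, χ (π x) = x ∧ ∀ z ∈ orb φ (π x), Φ (χ z) = χ (φ z)}

/-- The set of periodic points of a map. -/
def PerSet {α : Type*} (g : α → α) : Set α := {x | ∃ n : ℕ, 1 ≤ n ∧ g^[n] x = x}

/-- The set of synchronized periodic points: periodic points of `Φ` whose minimal
period is not greater than the minimal period of their base point under `φ`. -/
def SPerSet {𝔛 𝒵 : Type*} (Φ : 𝔛 → 𝔛) (φ : 𝒵 → 𝒵) (π : 𝔛 → 𝒵) : Set 𝔛 :=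
  {x | ∃ n : ℕ, 1 ≤ n ∧ Φ^[n] x = x ∧ ∀ m : ℕ, 1 ≤ m → m < n → φ^[m] (π x) ≠ π x}

/-- For a periodic point, the natural bi-infinite periodic solution. -/
theorem aux_periodic_step {α : Type*} (f : α → α) (x : α) (n : ℕ) (hn : 1 ≤ n)
    (hx : f^[n] x = x) (t : ℤ) :
    f^[((t + 1) % (n : ℤ)).toNat] x = f (f^[(t % (n : ℤ)).toNat] x) := by
  have hn0 : (n : ℤ) ≠ 0 := by omega
  have h0 : 0 ≤ t % (n : ℤ) := Int.emod_nonneg _ hn0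
  have h1 : 0 ≤ (t + 1) % (n : ℤ) := Int.emod_nonneg _ hn0
  have h : ((t + 1) % (n : ℤ)).toNat = ((t % (n : ℤ)).toNat + 1) % n := by
    zify
    rw [Int.toNat_of_nonneg h0, Int.toNat_of_nonneg h1, Int.emod_add_emod]
  have hp : Function.IsPeriodicPt f n x := hx
  rw [h, hp.iterate_mod_apply, Function.iterate_succ_apply']

theorem aux_per_subset_sol {α : Type*} (f : α → α) : PerSet f ⊆ SolSet f := by
  rintro x ⟨n, hn, hx⟩
  exact ⟨fun t => f^[(t % (n : ℤ)).toNat] x, by simp, aux_periodic_step f x n hn hx⟩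

theorem aux_zpow_nat {α : Type*} (e : Equiv.Perm α) (n : ℕ) (z : α) :
    (e ^ (n : ℤ)) z = e^[n] z := by
  rw [zpow_natCast, Equiv.Perm.iterate_eq_pow]

theorem aux_mem_orb {α : Type*} (e : Equiv.Perm α) (z0 z : α) :
    z ∈ orb e z0 ↔ ∃ t : ℤ, (e ^ t) z0 = z := by
  constructor
  · rintro ⟨n, h | h⟩
    · exact ⟨n, by rw [aux_zpow_nat, h]⟩
    · refine ⟨-n, ?_⟩
      rw [← h, ← aux_zpow_nat, ← Equiv.Perm.mul_apply, ← zpow_add]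
      simp
  · rintro ⟨t, rfl⟩
    obtain ⟨n, rfl | rfl⟩ := t.eq_nat_or_neg
    · exact ⟨n, Or.inl (aux_zpow_nat e n z0).symm⟩
    · refine ⟨n, Or.inr ?_⟩
      rw [← aux_zpow_nat, ← Equiv.Perm.mul_apply, ← zpow_add]
      simp

theorem aux_zpow_succ {α : Type*} (e : Equiv.Perm α) (t : ℤ) (z : α) :
    (e ^ (t + 1)) z = e ((e ^ t) z) := by
  rw [add_comm, zpow_add, zpow_one, Equiv.Perm.mul_apply]

theorem aux_zpow_sub {α : Type*} (e : Equiv.Perm α) (s t : ℤ) (z : α)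
    (h : (e ^ s) z = (e ^ t) z) : (e ^ (s - t)) z = z := by
  rw [show s - t = -t + s by ring, zpow_add, Equiv.Perm.mul_apply, h,
    ← Equiv.Perm.mul_apply, ← zpow_add]
  simp

/-- A solution compatible with coincidences on the base orbit gives a synchronized one. -/
theorem aux_sync {𝔛 𝒵 : Type*} (Φ : 𝔛 → 𝔛) (e : Equiv.Perm 𝒵) (π : 𝔛 → 𝒵) (x : 𝔛)
    (c : ℤ → 𝔛) (h0 : c 0 = x) (hc : ∀ t, c (t + 1) = Φ (c t))
    (hw : ∀ s t : ℤ, (e ^ s) (π x) = (e ^ t) (π x) → c s = c t) :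
    x ∈ SyncSolSet Φ e π := by
  classical
  let χ : 𝒵 → 𝔛 := fun z => if h : ∃ t : ℤ, (e ^ t) (π x) = z then c h.choose else x
  have key : ∀ t : ℤ, χ ((e ^ t) (π x)) = c t := by
    intro t
    have h : ∃ s : ℤ, (e ^ s) (π x) = (e ^ t) (π x) := ⟨t, rfl⟩
    simp only [χ, dif_pos h]
    exact hw _ _ h.choose_spec
  refine ⟨χ, ?_, ?_⟩
  · have := key 0
    simpa [h0] using this
  · intro z hz
    obtain ⟨t, rfl⟩ := (aux_mem_orb e _ _).1 hz
    rw [key, ← aux_zpow_succ, key, hc]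

/-- If `e ^ k` fixes `z`, then `|k|` iterates fix `z`. -/
theorem aux_natAbs {α : Type*} (e : Equiv.Perm α) (k : ℤ) (z : α) (h : (e ^ k) z = z) :
    e^[k.natAbs] z = z := by
  rw [← aux_zpow_nat]
  obtain h1 | h1 := k.natAbs_eq
  · rwa [← h1]
  · rw [show (k.natAbs : ℤ) = 0 - k by omega]
    exact aux_zpow_sub e 0 k z (by rw [h]; simp)

theorem aux_dvd {α : Type*} (e : Equiv.Perm α) (z : α) (n : ℕ) (hn : 1 ≤ n)
    (hz : e^[n] z = z) (hmin : ∀ m : ℕ, 1 ≤ m → m < n → e^[m] z ≠ z)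
    (k : ℤ) (h : (e ^ k) z = z) : (n : ℤ) ∣ k := by
  have h1 := aux_natAbs e k z h
  have hp : Function.IsPeriodicPt e n z := hz
  have h2 : e^[k.natAbs % n] z = z := by rw [hp.iterate_mod_apply, h1]
  have h3 : k.natAbs % n < n := Nat.mod_lt _ hn
  have h4 : k.natAbs % n = 0 := by
    by_contra hne
    exact hmin _ (Nat.one_le_iff_ne_zero.2 hne) h3 h2
  exact Int.natCast_dvd.2 (Nat.dvd_of_mod_eq_zero h4)

theorem aux_first {𝔛 𝒵 : Type*} (π : 𝔛 → 𝒵) (e : Equiv.Perm 𝒵) (Φ : 𝔛 → 𝔛)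
    (hb : Function.Semiconj π Φ e) :
    SyncSolSet Φ e π = (SolSet Φ ∩ π ⁻¹' (PerSet e)ᶜ) ∪ SPerSet Φ e π := by
  classical
  ext x
  constructor
  · rintro ⟨χ, h0, hχ⟩
    have hs : ∀ t : ℤ, χ ((e ^ (t + 1)) (π x)) = Φ (χ ((e ^ t) (π x))) := by
      intro t
      rw [hχ _ ((aux_mem_orb e _ _).2 ⟨t, rfl⟩), aux_zpow_succ]
    by_cases hp : π x ∈ PerSet e
    · right
      have hp' : ∃ n : ℕ, 1 ≤ n ∧ e^[n] (π x) = π x := hp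
      have hit : ∀ n : ℕ, Φ^[n] x = χ (e^[n] (π x)) := by
        intro n
        induction n with
        | zero => simp [h0]
        | succ k ih =>
          rw [Function.iterate_succ_apply', ih, Function.iterate_succ_apply']
          exact hχ _ ⟨k, Or.inl rfl⟩
      refine ⟨Nat.find hp', (Nat.find_spec hp').1, ?_, ?_⟩
      · rw [hit, (Nat.find_spec hp').2, h0]
      · intro m h1 hm h2
        exact Nat.find_min hp' hm ⟨h1, h2⟩
    · left
      exact ⟨⟨fun t => χ ((e ^ t) (π x)), by simp [h0], hs⟩, hp⟩
  · rintro (⟨⟨c, h0, hc⟩, hp⟩ | ⟨n, hn, hx, hmin⟩)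
    · refine aux_sync Φ e π x c h0 hc fun s t hst => ?_
      have h := aux_natAbs e _ _ (aux_zpow_sub e s t _ hst)
      have : s = t := by
        by_contra hne
        exact hp ⟨(s - t).natAbs, by omega, h⟩
      rw [this]
    · have hz : e^[n] (π x) = π x := by
        rw [← (hb.iterate_right n).eq, hx]
      refine aux_sync Φ e π x (fun t => Φ^[(t % (n : ℤ)).toNat] x) (by simp)
        (aux_periodic_step Φ x n hn hx) fun s t hst => ?_
      have hd := aux_dvd e _ n hn hz hmin _ (aux_zpow_sub e s t _ hst)
      have : s % (n : ℤ) = t % (n : ℤ) := Int.emod_eq_emod_iff_emod_sub_eq_zero.2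
        (Int.emod_eq_zero_of_dvd hd)
      simp only [this]

theorem stmt5 {𝔛 𝒵 : Type*} [TopologicalSpace 𝔛] [TopologicalSpace 𝒵]
    [T2Space 𝔛] [T2Space 𝒵]
    (π : 𝔛 → 𝒵) (hπ : Continuous π)
    (φ : 𝒵 → 𝒵) (hφc : Continuous φ) (hφb : Function.Bijective φ)
    (Φ : 𝔛 → 𝔛) (hΦc : Continuous Φ) (hbundle : π ∘ Φ = φ ∘ π) :
    SyncSolSet Φ φ π = (SolSet Φ ∩ π ⁻¹' (PerSet φ)ᶜ) ∪ SPerSet Φ φ π ∧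
    SolSet Φ \ SyncSolSet Φ φ π =
      (SolSet Φ ∩ (PerSet Φ)ᶜ ∩ π ⁻¹' (PerSet φ)) ∪ (PerSet Φ \ SPerSet Φ φ π) := by
  have hb : Function.Semiconj π Φ φ := fun x => congrFun hbundle x
  have h1 : SyncSolSet Φ φ π = (SolSet Φ ∩ π ⁻¹' (PerSet φ)ᶜ) ∪ SPerSet Φ φ π :=
    aux_first π (Equiv.ofBijective φ hφb) Φ hb
  refine ⟨h1, ?_⟩
  have hsub : SPerSet Φ φ π ⊆ PerSet Φ := fun x ⟨n, hn, hx, _⟩ => ⟨n, hn, hx⟩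
  have hsol := aux_per_subset_sol Φ
  have hper : ∀ x ∈ PerSet Φ, π x ∈ PerSet φ := by
    rintro x ⟨n, hn, hx⟩
    exact ⟨n, hn, by rw [← (hb.iterate_right n).eq, hx]⟩
  rw [h1]
  ext x
  have a := @hsub x
  have b := @hsol x
  have c := hper x
  simp only [Set.mem_sdiff, mem_union, mem_inter_iff, mem_preimage, mem_compl_iff]
  tauto
end

section
/- Let Ω be a topological space equipped with its Borel σ-algebra, and for i = 1, 2, 3 let Σ_i be the σ-algebra generated by a continuous map V_i : Ω → 𝒱_i into a Polish space 𝒱_i. Let P be a Borel probability measure on Ω, and suppose there exists a sequence (P_n)_{n∈ℕ} of Borel probability measures on Ω such that: (i) Σ₁ and Σ₃ are conditionally independent given Σ₂ with respect to P_n for all n; (ii) (V₂ × V₃)_*P_n = (V₂ × V₃)_*P for all n; (iii) (V₁ × V₂ × V₃)_*P is an accumulation point of the sequence ((V₁ × V₂ × V₃)_*P_n)_{n∈ℕ} in the topology of weak convergence of Borel probability measures on 𝒱₁ × 𝒱₂ × 𝒱₃. Then Σ₁ and Σ₃ are conditionally independent given Σ₂ with respect to P. -/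
open Set Filter Topology MeasureTheory

/-- `Σ₁` and `Σ₃` are conditionally independent given `Σ₂` with respect to `μ`:
`E[β₁β₃ | Σ₂] = E[β₁ | Σ₂]·E[β₃ | Σ₂]` a.s. for all bounded `Σ₁`- resp.
`Σ₃`-measurable real functions `β₁`, `β₃`. -/
def CondIndepGiven {Ω : Type*} [MeasurableSpace Ω] (μ : Measure Ω)
    (m₁ m₂ m₃ : MeasurableSpace Ω) : Prop :=
  ∀ β₁ β₃ : Ω → ℝ, Measurable[m₁] β₁ → Measurable[m₃] β₃ →
    (∃ C : ℝ, ∀ ω, |β₁ ω| ≤ C) → (∃ C : ℝ, ∀ ω, |β₃ ω| ≤ C) →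
    (μ[fun ω => β₁ ω * β₃ ω|m₂]) =ᵐ[μ] fun ω => (μ[β₁|m₂]) ω * (μ[β₃|m₂]) ω

open scoped BoundedContinuousFunction

lemma aux_int {Ω : Type*} [MeasurableSpace Ω] {μ : Measure Ω} [IsProbabilityMeasure μ]
    {f : Ω → ℝ} (hf : Measurable f) (hb : ∃ C : ℝ, ∀ ω, |f ω| ≤ C) : Integrable f μ := by
  obtain ⟨C, hC⟩ := hb
  exact Integrable.of_bound hf.aestronglyMeasurable C (ae_of_all _ hC)

lemma aux_bmul {Ω : Type*} {f g : Ω → ℝ} (hf : ∃ C : ℝ, ∀ ω, |f ω| ≤ C)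
    (hg : ∃ C : ℝ, ∀ ω, |g ω| ≤ C) : ∃ C : ℝ, ∀ ω, |(f * g) ω| ≤ C := by
  obtain ⟨C, hC⟩ := hf
  obtain ⟨D, hD⟩ := hg
  refine ⟨C * D, fun ω => ?_⟩
  rw [Pi.mul_apply, abs_mul]
  exact mul_le_mul (hC ω) (hD ω) (abs_nonneg _) ((abs_nonneg _).trans (hC ω))

lemma aux_condD {Ω : Type*} {m₂ m₀ : MeasurableSpace Ω} (hm : m₂ ≤ m₀) {μ : Measure Ω}
    [IsProbabilityMeasure μ] {b₁ b₃ k : Ω → ℝ} (h₁ : Measurable b₁) (h₃ : Measurable b₃)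
    (hk : Measurable[m₂] k) (hb₁ : ∃ C : ℝ, ∀ ω, |b₁ ω| ≤ C) (hb₃ : ∃ C : ℝ, ∀ ω, |b₃ ω| ≤ C)
    (hbk : ∃ C : ℝ, ∀ ω, |k ω| ≤ C) (hke : k =ᵐ[μ] μ[b₃|m₂]) :
    (μ[fun ω => b₁ ω * b₃ ω|m₂] =ᵐ[μ] fun ω => (μ[b₁|m₂]) ω * (μ[b₃|m₂]) ω) ↔
      μ[b₁ * b₃ - b₁ * k|m₂] =ᵐ[μ] 0 := by
  have hk0 : Measurable k := hk.mono hm le_rfl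
  have i13 : Integrable (b₁ * b₃) μ := aux_int (h₁.mul h₃) (aux_bmul hb₁ hb₃)
  have i1k : Integrable (b₁ * k) μ := aux_int (h₁.mul hk0) (aux_bmul hb₁ hbk)
  have e1 := condExp_sub i13 i1k m₂
  have e2 := condExp_mul_of_stronglyMeasurable_right hk.stronglyMeasurable i1k
    (aux_int (μ := μ) h₁ hb₁)
  change (μ[b₁ * b₃|m₂] =ᵐ[μ] _) ↔ _
  constructor
  · intro h
    filter_upwards [h, e1, e2, hke] with ω a1 a2 a3 a4
    simp only [Pi.sub_apply, Pi.mul_apply, Pi.zero_apply] at *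
    rw [a2, a1, a3, a4, sub_self]
  · intro h
    filter_upwards [h, e1, e2, hke] with ω a1 a2 a3 a4
    simp only [Pi.sub_apply, Pi.mul_apply, Pi.zero_apply] at *
    rw [a3, a1, a4] at a2
    linarith

lemma aux_approx {X : Type*} [TopologicalSpace X] [PolishSpace X] [MeasurableSpace X]
    [BorelSpace X] {μ : Measure X} [IsFiniteMeasure μ] {f : X → ℝ} (hf : Integrable f μ)
    {ε : ℝ} (hε : 0 < ε) :
    ∃ g : X →ᵇ ℝ, (∫ x, ‖f x - g x‖ ∂μ) ≤ ε ∧ Integrable g μ := by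
  letI := TopologicalSpace.upgradeIsCompletelyMetrizable X
  exact hf.exists_boundedContinuous_integral_sub_le hε

/-- Replacing an integrable factor by an approximation. -/
lemma aux_close {Ω X : Type*} [MeasurableSpace Ω] [MeasurableSpace X] {μ : Measure Ω}
    {V : Ω → X} (hV : Measurable V) {f g : X → ℝ} (hf : Integrable f (μ.map V))
    (hg : Integrable g (μ.map V)) {ε C : ℝ} (h : ∫ x, ‖f x - g x‖ ∂(μ.map V) ≤ ε)
    {ψ : Ω → ℝ} (hψ : Measurable ψ) (hC0 : 0 ≤ C) (hC : ∀ ω, |ψ ω| ≤ C) :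
    |∫ ω, ψ ω * f (V ω) ∂μ - ∫ ω, ψ ω * g (V ω) ∂μ| ≤ C * ε := by
  have hf' := hf.comp_measurable hV
  have hg' := hg.comp_measurable hV
  have j : ∀ {u : X → ℝ}, Integrable (u ∘ V) μ → Integrable (fun ω => ψ ω * u (V ω)) μ :=
    fun hu => hu.bdd_mul (c := C) hψ.aestronglyMeasurable (ae_of_all _ hC)
  rw [← integral_sub (j hf') (j hg')]
  rw [integral_map (f := fun x => ‖f x - g x‖) hV.aemeasurable
    (hf.sub hg).norm.aestronglyMeasurable] at h
  calc |∫ ω, ψ ω * f (V ω) - ψ ω * g (V ω) ∂μ|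
      ≤ ∫ ω, |ψ ω * f (V ω) - ψ ω * g (V ω)| ∂μ := abs_integral_le_integral_abs
    _ ≤ ∫ ω, C * ‖f (V ω) - g (V ω)‖ ∂μ := by
        refine integral_mono ((j hf').sub (j hg')).abs ((hf'.sub hg').norm.const_mul C) ?_
        intro ω
        simp only [← mul_sub, abs_mul, Real.norm_eq_abs]
        exact mul_le_mul_of_nonneg_right (hC ω) (abs_nonneg _)
    _ ≤ C * ε := by
        rw [integral_const_mul]
        exact mul_le_mul_of_nonneg_left h hC0

lemma aux_small {a C : ℝ} (hC : 0 ≤ C) (h : ∀ ε > 0, |a| ≤ C * ε) : a = 0 := by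
  by_contra ha
  have ha' : 0 < |a| := abs_pos.2 ha
  have h1 := h (|a| / (2 * (C + 1))) (by positivity)
  have : C * (|a| / (2 * (C + 1))) < |a| := by
    rw [mul_div_assoc', div_lt_iff₀ (by positivity)]
    nlinarith
  linarith

theorem stmt19 {Ω 𝒱₁ 𝒱₂ 𝒱₃ : Type*}
    [TopologicalSpace Ω] [MeasurableSpace Ω] [BorelSpace Ω]
    [TopologicalSpace 𝒱₁] [PolishSpace 𝒱₁] [MeasurableSpace 𝒱₁] [BorelSpace 𝒱₁]
    [TopologicalSpace 𝒱₂] [PolishSpace 𝒱₂] [MeasurableSpace 𝒱₂] [BorelSpace 𝒱₂]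
    [TopologicalSpace 𝒱₃] [PolishSpace 𝒱₃] [MeasurableSpace 𝒱₃] [BorelSpace 𝒱₃]
    (V₁ : Ω → 𝒱₁) (V₂ : Ω → 𝒱₂) (V₃ : Ω → 𝒱₃)
    (hV₁ : Continuous V₁) (hV₂ : Continuous V₂) (hV₃ : Continuous V₃)
    (P : Measure Ω) [IsProbabilityMeasure P]
    (Pn : ℕ → Measure Ω) (hPn : ∀ n, IsProbabilityMeasure (Pn n))
    -- (i): Σ₁ ⫫ Σ₃ | Σ₂ with respect to each Pₙ
    (h1 : ∀ n : ℕ, CondIndepGiven (Pn n)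
      (MeasurableSpace.comap V₁ inferInstance)
      (MeasurableSpace.comap V₂ inferInstance)
      (MeasurableSpace.comap V₃ inferInstance))
    -- (ii): (V₂ × V₃)_*Pₙ = (V₂ × V₃)_*P for all n
    (h2 : ∀ n : ℕ, Measure.map (fun ω => (V₂ ω, V₃ ω)) (Pn n) =
      Measure.map (fun ω => (V₂ ω, V₃ ω)) P)
    -- (iii): (V₁ × V₂ × V₃)_*P is an accumulation point of ((V₁ × V₂ × V₃)_*Pₙ)ₙ
    -- in the topology of weak convergence of Borel probability measures
    (Qn : ℕ → ProbabilityMeasure (𝒱₁ × 𝒱₂ × 𝒱₃)) (Q : ProbabilityMeasure (𝒱₁ × 𝒱₂ × 𝒱₃))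
    (hQn : ∀ n : ℕ, (Qn n : Measure (𝒱₁ × 𝒱₂ × 𝒱₃)) =
      Measure.map (fun ω => (V₁ ω, V₂ ω, V₃ ω)) (Pn n))
    (hQ : (Q : Measure (𝒱₁ × 𝒱₂ × 𝒱₃)) = Measure.map (fun ω => (V₁ ω, V₂ ω, V₃ ω)) P)
    (h3 : MapClusterPt Q Filter.atTop Qn) :
    -- then Σ₁ ⫫ Σ₃ | Σ₂ with respect to P
    CondIndepGiven P (MeasurableSpace.comap V₁ inferInstance)
      (MeasurableSpace.comap V₂ inferInstance)
      (MeasurableSpace.comap V₃ inferInstance) := by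
  intro β₁ β₃ hβ₁ hβ₃ hb₁ hb₃
  have mV₁ := hV₁.measurable
  have mV₂ := hV₂.measurable
  have mV₃ := hV₃.measurable
  have le1 := mV₁.comap_le
  have le2 := mV₂.comap_le
  have le3 := mV₃.comap_le
  obtain ⟨h, hh, rfl⟩ := hβ₃.exists_eq_measurable_comp
  obtain ⟨f₀, hf₀, rfl⟩ := hβ₁.exists_eq_measurable_comp
  have m1 : Measurable (f₀ ∘ V₁) := hf₀.comp mV₁
  have m3 : Measurable (h ∘ V₃) := hh.comp mV₃
  have m23 : Measurable (fun ω => (V₂ ω, V₃ ω)) := mV₂.prodMk mV₃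
  have m123 : Measurable (fun ω => (V₁ ω, V₂ ω, V₃ ω)) := mV₁.prodMk m23
  -- a bounded everywhere version of the conditional expectation
  obtain ⟨k, hk, hbk, hke⟩ : ∃ k : 𝒱₂ → ℝ, Measurable k ∧ (∃ C : ℝ, ∀ v, |k v| ≤ C) ∧
      k ∘ V₂ =ᵐ[P] P[h ∘ V₃|MeasurableSpace.comap V₂ inferInstance] := by
    obtain ⟨C, hC⟩ := hb₃
    have hC' : ∀ ω, |(h ∘ V₃) ω| ≤ (C.toNNReal : ℝ) :=
      fun ω => (hC ω).trans (Real.le_coe_toNNReal C)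
    obtain ⟨k, hk, hke⟩ := (stronglyMeasurable_condExp (f := h ∘ V₃) (μ := P)
      (m := MeasurableSpace.comap V₂ inferInstance)).exists_eq_measurable_comp
    have hbd := ae_bdd_condExp_of_ae_bdd (m := MeasurableSpace.comap V₂ inferInstance)
      (ae_of_all P hC')
    refine ⟨fun v => max (-(C.toNNReal : ℝ)) (min (C.toNNReal : ℝ) (k v)),
      measurable_const.max (measurable_const.min hk.measurable), ⟨C.toNNReal, fun v => ?_⟩, ?_⟩
    · rw [abs_le]
      exact ⟨le_max_left _ _, max_le (by simp) (min_le_left _ _)⟩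
    · filter_upwards [hbd] with ω hω
      rw [hke, abs_le] at hω
      rw [hke]
      simp only [Function.comp_apply] at hω ⊢
      rw [min_eq_right hω.2, max_eq_right hω.1]
  have mk2 : Measurable[MeasurableSpace.comap V₂ inferInstance] (k ∘ V₂) :=
    hk.comp (comap_measurable V₂)
  have mk : Measurable (k ∘ V₂) := hk.comp mV₂
  have hbk' : ∃ C : ℝ, ∀ ω, |(k ∘ V₂) ω| ≤ C := by
    obtain ⟨C, hC⟩ := hbk
    exact ⟨C, fun ω => hC _⟩
  -- it is a version for every `Pn n`
  have tr : ∀ n (A : Set 𝒱₂) (u : 𝒱₂ × 𝒱₃ → ℝ), MeasurableSet A → Measurable u →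
      ∫ ω in V₂ ⁻¹' A, u (V₂ ω, V₃ ω) ∂(Pn n) = ∫ ω in V₂ ⁻¹' A, u (V₂ ω, V₃ ω) ∂P := by
    intro n A u hA hu
    have key : ∀ μ : Measure Ω, ∫ ω in V₂ ⁻¹' A, u (V₂ ω, V₃ ω) ∂μ =
        ∫ x in Prod.fst ⁻¹' A, u x ∂(μ.map (fun ω => (V₂ ω, V₃ ω))) := by
      intro μ
      rw [setIntegral_map (measurable_fst hA) hu.aestronglyMeasurable m23.aemeasurable]
      rfl
    rw [key, key, h2]
  have hken : ∀ n, k ∘ V₂ =ᵐ[Pn n] (Pn n)[h ∘ V₃|MeasurableSpace.comap V₂ inferInstance] := by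
    intro n
    haveI := hPn n
    refine ae_eq_condExp_of_forall_setIntegral_eq le2 (aux_int m3 hb₃)
      (fun s _ _ => (aux_int mk hbk').integrableOn) ?_ mk2.aestronglyMeasurable
    rintro s ⟨A, hA, rfl⟩ -
    have t1 := tr n A (fun x => k x.1) hA (hk.comp measurable_fst)
    have t2 := tr n A (fun x => h x.2) hA (hh.comp measurable_snd)
    simp only [Function.comp_apply]
    rw [t1, t2]
    refine Eq.trans ?_ (setIntegral_condExp le2 (aux_int (μ := P) m3 hb₃) ⟨A, hA, rfl⟩)
    refine integral_congr_ae (ae_restrict_of_ae ?_)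
    exact hke
  refine (aux_condD le2 m1 m3 mk2 hb₁ hb₃ hbk' hke).2 ?_
  have iD : Integrable (f₀ ∘ V₁ * h ∘ V₃ - f₀ ∘ V₁ * k ∘ V₂) P :=
    (aux_int (m1.mul m3) (aux_bmul hb₁ hb₃)).sub (aux_int (m1.mul mk) (aux_bmul hb₁ hbk'))
  refine (ae_eq_condExp_of_forall_setIntegral_eq le2 iD (fun s _ _ => integrableOn_zero) ?_
    aestronglyMeasurable_zero).symm
  rintro s ⟨A, hA, rfl⟩ -
  simp only [Pi.zero_apply, integral_zero]
  symm
  -- the test function of `(V₂, V₃)`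
  set φ : 𝒱₂ × 𝒱₃ → ℝ := (Prod.fst ⁻¹' A).indicator (fun x => h x.2 - k x.1) with hφ
  have mφ : Measurable φ :=
    ((hh.comp measurable_snd).sub (hk.comp measurable_fst)).indicator (measurable_fst hA)
  have bφ : ∃ C : ℝ, 0 ≤ C ∧ ∀ ω, |φ (V₂ ω, V₃ ω)| ≤ C := by
    obtain ⟨C, hC⟩ := hb₃
    obtain ⟨D, hD⟩ := hbk
    refine ⟨|C| + |D|, by positivity, fun ω => ?_⟩
    have a1 := (hC ω).trans (le_abs_self C)
    have a2 := (hD (V₂ ω)).trans (le_abs_self D)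
    simp only [hφ, Set.indicator]
    split_ifs
    · exact (abs_sub _ _).trans (add_le_add a1 a2)
    · simpa using by positivity
  have hint : ∀ (μ : Measure Ω) (f : 𝒱₁ → ℝ),
      ∫ ω in V₂ ⁻¹' A, (f ∘ V₁ * h ∘ V₃ - f ∘ V₁ * k ∘ V₂) ω ∂μ =
        ∫ ω, f (V₁ ω) * φ (V₂ ω, V₃ ω) ∂μ := by
    intro μ f
    rw [← integral_indicator (mV₂ hA)]
    congr 1
    ext ω
    by_cases hω : V₂ ω ∈ A
    · simp [hφ, hω, Set.indicator, mul_sub]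
    · simp [hφ, hω, Set.indicator]
  rw [hint]
  have φint : ∀ μ : Measure Ω, IsProbabilityMeasure μ →
      Integrable φ (μ.map (fun ω => (V₂ ω, V₃ ω))) := by
    intro μ _
    rw [integrable_map_measure mφ.aestronglyMeasurable m23.aemeasurable]
    obtain ⟨C, -, hC⟩ := bφ
    exact aux_int (mφ.comp m23) ⟨C, hC⟩
  -- vanishing for `Pn n`
  have hn0 : ∀ n (f : 𝒱₁ →ᵇ ℝ), ∫ ω, f (V₁ ω) * φ (V₂ ω, V₃ ω) ∂(Pn n) = 0 := by
    intro n f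
    haveI := hPn n
    have mf : Measurable (f ∘ V₁) := f.continuous.measurable.comp mV₁
    have bf : ∃ C : ℝ, ∀ ω, |(f ∘ V₁) ω| ≤ C := ⟨‖f‖, fun ω => f.norm_coe_le_norm _⟩
    have c := (aux_condD le2 mf m3 mk2 bf hb₃ hbk' (hken n)).1
      (h1 n (f ∘ V₁) (h ∘ V₃) (f.continuous.measurable.comp (comap_measurable V₁)) hβ₃ bf hb₃)
    rw [← hint, ← setIntegral_condExp le2 ((aux_int (mf.mul m3) (aux_bmul bf hb₃)).sub
      (aux_int (mf.mul mk) (aux_bmul bf hbk'))) ⟨A, hA, rfl⟩]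
    rw [integral_congr_ae (ae_restrict_of_ae c)]
    simp
  -- vanishing for `P`, continuous test functions
  have hP0 : ∀ f : 𝒱₁ →ᵇ ℝ, ∫ ω, f (V₁ ω) * φ (V₂ ω, V₃ ω) ∂P = 0 := by
    intro f
    have mf : Measurable (f ∘ V₁) := f.continuous.measurable.comp mV₁
    refine aux_small (C := ‖f‖ + ‖f‖) (by positivity) fun ε hε => ?_
    haveI : IsProbabilityMeasure (P.map (fun ω => (V₂ ω, V₃ ω))) :=
      Measure.isProbabilityMeasure_map m23.aemeasurable
    obtain ⟨g, hg, ig⟩ := aux_approx (φint P inferInstance) hε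
    have cP := aux_close m23 (φint P inferInstance) ig hg mf (norm_nonneg f)
      (fun ω => f.norm_coe_le_norm _)
    have cn : ∀ n, |∫ ω, f (V₁ ω) * g (V₂ ω, V₃ ω) ∂(Pn n)| ≤ ‖f‖ * ε := by
      intro n
      have c := aux_close (μ := Pn n) (ε := ε) m23 (φint (Pn n) (hPn n)) (by rw [h2]; exact ig)
        (by rw [h2]; exact hg) mf (norm_nonneg f) (fun ω => f.norm_coe_le_norm _)
      simp only [Function.comp_apply] at c
      rwa [hn0, zero_sub, abs_neg] at c
    let F : (𝒱₁ × 𝒱₂ × 𝒱₃) →ᵇ ℝ :=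
      f.compContinuous ⟨Prod.fst, continuous_fst⟩ * g.compContinuous ⟨Prod.snd, continuous_snd⟩
    have hF : ∀ μ : Measure Ω, ∫ x, F x ∂(μ.map (fun ω => (V₁ ω, V₂ ω, V₃ ω))) =
        ∫ ω, f (V₁ ω) * g (V₂ ω, V₃ ω) ∂μ := by
      intro μ
      rw [integral_map m123.aemeasurable F.continuous.measurable.aestronglyMeasurable]
      rfl
    have hcl := h3.continuousAt_comp
      (ProbabilityMeasure.continuous_integral_boundedContinuousFunction F).continuousAt
    have hmem := (isClosed_Icc (a := -(‖f‖ * ε)) (b := ‖f‖ * ε)).mem_of_mapClusterPt hcl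
      (Eventually.of_forall fun n => by
        simp only [Function.comp_apply]
        rw [hQn, hF]
        exact abs_le.1 (cn n))
    rw [hQ, hF] at hmem
    have hmem' := abs_le.2 hmem
    simp only [Function.comp_apply] at cP
    have := abs_add_le (∫ ω, f (V₁ ω) * φ (V₂ ω, V₃ ω) ∂P - ∫ ω, f (V₁ ω) * g (V₂ ω, V₃ ω) ∂P)
      (∫ ω, f (V₁ ω) * g (V₂ ω, V₃ ω) ∂P)
    rw [sub_add_cancel] at this
    linarith
  -- general bounded measurable test functions
  obtain ⟨C, hC0, hC⟩ := bφ
  refine aux_small hC0 fun ε hε => ?_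
  haveI : IsProbabilityMeasure (P.map V₁) := Measure.isProbabilityMeasure_map mV₁.aemeasurable
  have if0 : Integrable f₀ (P.map V₁) := by
    rw [integrable_map_measure hf₀.aestronglyMeasurable mV₁.aemeasurable]
    exact aux_int m1 hb₁
  obtain ⟨g, hg, ig⟩ := aux_approx if0 hε
  have c := aux_close mV₁ if0 ig hg (mφ.comp m23) hC0 hC
  have e := hP0 g
  simp only [mul_comm (g _)] at e
  simp only [Function.comp_apply] at c
  rw [e, sub_zero] at c
  simpa only [mul_comm (f₀ _)] using c
end
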